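/- Let ε = e^{2πi/5}, u_5(x,y) = x^8 + x^7y + 7x^6y^2 − 7x^5y^3 + 7x^3y^5 + 7x^2y^6 − xy^7 + y^8, and for k = 1,…,5 set u_k(x,y) = u_5(ε^{3k}x, ε^{2k}y). Let F(x,y) = x·y·(x^10 − 11x^5y^5 − y^10). Then the third elementary symmetric function ∑_{1 ≤ i < j < k ≤ 5} u_i·u_j·u_k equals 40·F^2 in ℂ[x,y]. -/

import Mathlib

open MvPolynomial

noncomputable def ε : ℂ := Complex.exp (2 * Real.pi * Complex.I / 5)

noncomputable def u5 : MvPolynomial (Fin 2) ℂ :=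
  (X 0) ^ 8 + (X 0) ^ 7 * X 1 + 7 * (X 0) ^ 6 * (X 1) ^ 2 - 7 * (X 0) ^ 5 * (X 1) ^ 3
    + 7 * (X 0) ^ 3 * (X 1) ^ 5 + 7 * (X 0) ^ 2 * (X 1) ^ 6 - X 0 * (X 1) ^ 7 + (X 1) ^ 8

/-- `u k` is `u5(ε^(3k) x, ε^(2k) y)`. -/
noncomputable def u (k : ℕ) : MvPolynomial (Fin 2) ℂ :=
  aeval ![C (ε ^ (3 * k)) * X 0, C (ε ^ (2 * k)) * X 1] u5

noncomputable def F : MvPolynomial (Fin 2) ℂ :=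
  X 0 * X 1 * ((X 0) ^ 10 - 11 * (X 0) ^ 5 * (X 1) ^ 5 - (X 1) ^ 10)

/-- If `t` satisfies the fifth cyclotomic equation, the third elementary symmetric function of the
values of `a T + b T ^ 2 + c T ^ 3 + d T ^ 4` at the powers of `t` does not depend on `t`. -/
theorem esymm3_of_cyclotomic {R : Type*} [CommRing R] {a b c d t : R}
    (ht : t ^ 4 + t ^ 3 + t ^ 2 + t + 1 = 0) {v₁ v₂ v₃ v₄ v₅ : R}
    (h₁ : v₁ = a * t + b * t ^ 2 + c * t ^ 3 + d * t ^ 4)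
    (h₂ : v₂ = a * t ^ 2 + b * t ^ 4 + c * t + d * t ^ 3)
    (h₃ : v₃ = a * t ^ 3 + b * t + c * t ^ 4 + d * t ^ 2)
    (h₄ : v₄ = a * t ^ 4 + b * t ^ 3 + c * t ^ 2 + d * t)
    (h₅ : v₅ = a + b + c + d) :
    v₁ * v₂ * v₃ + v₁ * v₂ * v₄ + v₁ * v₂ * v₅ + v₁ * v₃ * v₄ + v₁ * v₃ * v₅ + v₁ * v₄ * v₅
      + v₂ * v₃ * v₄ + v₂ * v₃ * v₅ + v₂ * v₄ * v₅ + v₃ * v₄ * v₅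
      = 5 * (a ^ 2 * c + a * b ^ 2 + b * d ^ 2 + c ^ 2 * d) := by
  subst h₁ h₂ h₃ h₄ h₅
  linear_combination
    ((-5 * a ^ 2 * c - 5 * a * b ^ 2 - 5 * b * d ^ 2 - 5 * c ^ 2 * d)
      + (5 * a ^ 2 * c + 5 * a * b ^ 2 + 5 * b * d ^ 2 + 5 * c ^ 2 * d) * t
      + (a ^ 2 * b + a ^ 2 * c + a ^ 2 * d + a * b ^ 2 + 3 * a * b * c + 3 * a * b * d + a * c
        ^ 2 + 3 * a * c * d + a * d ^ 2 + b ^ 2 * c + b ^ 2 * d + b * c ^ 2 + 3 * b * c * d + b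
        * d ^ 2 + c ^ 2 * d + c * d ^ 2) * t ^ 2
      + (a ^ 3 + a ^ 2 * b + a ^ 2 * c + 2 * a ^ 2 * d + a * b ^ 2 + 2 * a * b * c + 2 * a * b
        * d + a * c ^ 2 + 2 * a * c * d + 2 * a * d ^ 2 + b ^ 3 + 2 * b ^ 2 * c + b ^ 2 * d + 2
        * b * c ^ 2 + 2 * b * c * d + b * d ^ 2 + c ^ 3 + c ^ 2 * d + c * d ^ 2 + d ^ 3) * t ^ 3
      + (2 * a ^ 2 * b + a ^ 2 * c + 2 * a ^ 2 * d + a * b ^ 2 + 3 * a * b * c + 3 * a * b * d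
        + 2 * a * c ^ 2 + 3 * a * c * d + 2 * a * d ^ 2 + 2 * b ^ 2 * c + 2 * b ^ 2 * d + 2 * b
        * c ^ 2 + 3 * b * c * d + b * d ^ 2 + c ^ 2 * d + 2 * c * d ^ 2) * t ^ 4
      + (a ^ 3 + 2 * a ^ 2 * b - a ^ 2 * d + 2 * a * b * c + 2 * a * b * d + 2 * a * c ^ 2 + 2
        * a * c * d - a * d ^ 2 + b ^ 3 - b ^ 2 * c + 2 * b ^ 2 * d - b * c ^ 2 + 2 * b * c * d
        + c ^ 3 + 2 * c * d ^ 2 + d ^ 3) * t ^ 5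
      + (-a ^ 2 * b + 2 * a ^ 2 * c + a ^ 2 * d + 2 * a * b ^ 2 + a * b * c + a * b * d - a *
        c ^ 2 + a * c * d + a * d ^ 2 + b ^ 2 * c - b ^ 2 * d + b * c ^ 2 + b * c * d + 2 * b *
        d ^ 2 + 2 * c ^ 2 * d - c * d ^ 2) * t ^ 6
      + (a ^ 2 * b + a ^ 2 * d + a * c ^ 2 + a * d ^ 2 + b ^ 2 * c + b ^ 2 * d + b * c ^ 2 + c
        * d ^ 2) * t ^ 7
      + (a * b * c + a * b * d + a * c * d + b * c * d) * t ^ 8) * ht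

theorem ε_isPrimitiveRoot : IsPrimitiveRoot ε 5 := by
  simpa [ε] using Complex.isPrimitiveRoot_exp 5 (by norm_num)

theorem ε_cyclotomic : ε ^ 4 + ε ^ 3 + ε ^ 2 + ε + 1 = 0 := by
  have h := ε_isPrimitiveRoot.geom_sum_eq_zero (by norm_num)
  simp only [Finset.sum_range_succ, Finset.sum_range_zero] at h
  linear_combination h

/-- The decomposition of `u k` into eigenvectors of `(x, y) ↦ (ε ^ 3 x, ε ^ 2 y)`. -/
theorem u_eq (k : ℕ) {s : MvPolynomial (Fin 2) ℂ} (hs : s = C (ε ^ k)) :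
    u k = ((X 1) ^ 8 - 7 * (X 0) ^ 5 * (X 1) ^ 3) * s
      + (7 * (X 0) ^ 6 * (X 1) ^ 2 - X 0 * (X 1) ^ 7) * s ^ 2
      + ((X 0) ^ 7 * X 1 + 7 * (X 0) ^ 2 * (X 1) ^ 6) * s ^ 3
      + ((X 0) ^ 8 + 7 * (X 0) ^ 3 * (X 1) ^ 5) * s ^ 4 := by
  have h5 : s ^ 5 = 1 := by
    rw [hs, ← C_pow, ← pow_mul, mul_comm, pow_mul, ε_isPrimitiveRoot.pow_eq_one, one_pow, C_1]
  have h15 : s ^ 15 = 1 := by rw [show 15 = 5 * 3 from rfl, pow_mul, h5, one_pow]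
  have h20 : s ^ 20 = 1 := by rw [show 20 = 5 * 4 from rfl, pow_mul, h5, one_pow]
  have h2 : C (ε ^ (2 * k)) = s ^ 2 := by rw [hs, mul_comm, pow_mul, C_pow]
  have h3 : C (ε ^ (3 * k)) = s ^ 3 := by rw [hs, mul_comm, pow_mul, C_pow]
  simp only [u, u5, map_add, map_sub, map_mul, map_pow, map_ofNat, aeval_X, h2, h3,
    Matrix.cons_val_zero, Matrix.cons_val_one]
  linear_combination ((X 0) ^ 8 * s ^ 4 + (X 0) ^ 7 * X 1 * s ^ 3
      + 7 * (X 0) ^ 6 * (X 1) ^ 2 * s ^ 2 - 7 * (X 0) ^ 5 * (X 1) ^ 3 * s) * h20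
    + (7 * (X 0) ^ 3 * (X 1) ^ 5 * s ^ 4 + 7 * (X 0) ^ 2 * (X 1) ^ 6 * s ^ 3
      - X 0 * (X 1) ^ 7 * s ^ 2 + (X 1) ^ 8 * s) * h15

theorem esymm3_u_eq_40_F_sq :
    ∑ i ∈ Finset.Icc 1 5, ∑ j ∈ Finset.Icc (i + 1) 5, ∑ k ∈ Finset.Icc (j + 1) 5,
      u i * u j * u k = 40 * F ^ 2 := by
  have hC : (C ε : MvPolynomial (Fin 2) ℂ) ^ 4 + C ε ^ 3 + C ε ^ 2 + C ε + 1 = 0 := by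
    simp only [← C_pow, ← C_add, ← C_1, ε_cyclotomic, C_0]
  have h5 : (C ε : MvPolynomial (Fin 2) ℂ) ^ 5 = 1 := by
    linear_combination (C ε - 1) * hC
  have hu := fun k => u_eq k (C_pow ε k).symm
  generalize (C ε : MvPolynomial (Fin 2) ℂ) = t at hC h5 hu
  have key := esymm3_of_cyclotomic hC (v₁ := u 1) (v₂ := u 2) (v₃ := u 3) (v₄ := u 4) (v₅ := u 5)
    (a := (X 1) ^ 8 - 7 * (X 0) ^ 5 * (X 1) ^ 3) (b := 7 * (X 0) ^ 6 * (X 1) ^ 2 - X 0 * (X 1) ^ 7)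
    (c := (X 0) ^ 7 * X 1 + 7 * (X 0) ^ 2 * (X 1) ^ 6) (d := (X 0) ^ 8 + 7 * (X 0) ^ 3 * (X 1) ^ 5)
    (by simp [hu])
    (by
      rw [hu]
      linear_combination (((X 0) ^ 7 * X 1 + 7 * (X 0) ^ 2 * (X 1) ^ 6) * t
        + ((X 0) ^ 8 + 7 * (X 0) ^ 3 * (X 1) ^ 5) * t ^ 3) * h5)
    (by
      rw [hu]
      linear_combination ((7 * (X 0) ^ 6 * (X 1) ^ 2 - X 0 * (X 1) ^ 7) * t
        + ((X 0) ^ 7 * X 1 + 7 * (X 0) ^ 2 * (X 1) ^ 6) * t ^ 4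
        + ((X 0) ^ 8 + 7 * (X 0) ^ 3 * (X 1) ^ 5) * (t ^ 7 + t ^ 2)) * h5)
    (by
      rw [hu]
      linear_combination ((7 * (X 0) ^ 6 * (X 1) ^ 2 - X 0 * (X 1) ^ 7) * t ^ 3
        + ((X 0) ^ 7 * X 1 + 7 * (X 0) ^ 2 * (X 1) ^ 6) * (t ^ 7 + t ^ 2)
        + ((X 0) ^ 8 + 7 * (X 0) ^ 3 * (X 1) ^ 5) * (t ^ 11 + t ^ 6 + t)) * h5) (by simp [hu, h5])
  have hsum : ∑ i ∈ Finset.Icc 1 5, ∑ j ∈ Finset.Icc (i + 1) 5, ∑ k ∈ Finset.Icc (j + 1) 5,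
      u i * u j * u k = u 1 * u 2 * u 3 + u 1 * u 2 * u 4 + u 1 * u 2 * u 5 + u 1 * u 3 * u 4
        + u 1 * u 3 * u 5 + u 1 * u 4 * u 5 + u 2 * u 3 * u 4 + u 2 * u 3 * u 5 + u 2 * u 4 * u 5
        + u 3 * u 4 * u 5 := by
    simp [Finset.sum_Icc_succ_top]
    ring
  rw [hsum, key, F]
  ring
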